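/- Let S = <a, a+d, ..., a+wd> with gcd(a,d)=1 and 0 < w < a. For integers c1, c2 with 0 ≤ c2 < a, n = c1·a + c2·d ∈ S, the cardinality of the length set L_S(n) equals ⌊(c1·w − c2)/(a + wd)⌋ + 1. -/

import Mathlib

/-- Membership in the numerical monoid generated by `a + i*d` for `0 ≤ i ≤ w`
with the generators indexed by `G` omitted (`G = ∅` gives the full arithmetical monoid). -/
def AMem (a d w : ℕ) (G : Set ℕ) (n : ℤ) : Prop :=
  ∃ z : Fin (w + 1) → ℕ, (∀ i : Fin (w + 1), (i : ℕ) ∈ G → z i = 0) ∧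
    n = ∑ i : Fin (w + 1), (z i : ℤ) * ((a : ℤ) + ((i : ℕ) : ℤ) * (d : ℤ))

/-- The set of factorization lengths of `n` over the generators `a + i*d`, `0 ≤ i ≤ w`,
with the generators indexed by `G` omitted. -/
def ALen (a d w : ℕ) (G : Set ℕ) (n : ℤ) : Set ℤ :=
  {ℓ | ∃ z : Fin (w + 1) → ℕ, (∀ i : Fin (w + 1), (i : ℕ) ∈ G → z i = 0) ∧
    n = ∑ i : Fin (w + 1), (z i : ℤ) * ((a : ℤ) + ((i : ℕ) : ℤ) * (d : ℤ)) ∧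
    (∑ i : Fin (w + 1), (z i : ℤ)) = ℓ}

/-- The set of length sets. -/
def ALenSets (a d w : ℕ) (G : Set ℕ) : Set (Set ℤ) :=
  {L | ∃ n : ℤ, AMem a d w G n ∧ L = ALen a d w G n}

/-- Every `k ≤ l * w` is a sum of `l` integers from `{0, …, w}`, recorded by multiplicities. -/
theorem exists_multiplicities (w l : ℕ) : ∀ k : ℕ, k ≤ l * w →
    ∃ z : Fin (w + 1) → ℕ, ∑ i, (z i : ℤ) = l ∧ ∑ i, (z i : ℤ) * ((i : ℕ) : ℤ) = k := by
  induction l with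
  | zero =>
    intro k hk
    exact ⟨0, by simp, by simp; omega⟩
  | succ l ih =>
    intro k hk
    rw [Nat.succ_mul] at hk
    obtain ⟨z, h1, h2⟩ := ih (k - min k w) (by omega)
    refine ⟨fun i => z i + if i = ⟨min k w, by omega⟩ then 1 else 0, ?_, ?_⟩
    · simp [Finset.sum_add_distrib, h1]
    · simp only [Nat.cast_add, Nat.cast_ite, Nat.cast_one, Nat.cast_zero, add_mul, ite_mul, one_mul,
        zero_mul, Finset.sum_add_distrib, h2, Finset.sum_ite_eq', Finset.mem_univ, if_true]
      omega

theorem mem_ALen_empty_iff (a d w : ℕ) (n l : ℤ) :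
    l ∈ ALen a d w ∅ n ↔ 0 ≤ l ∧ ∃ k : ℤ, 0 ≤ k ∧ k ≤ l * w ∧ n = l * a + k * d := by
  have split (z : Fin (w + 1) → ℕ) :
      ∑ i : Fin (w + 1), (z i : ℤ) * ((a : ℤ) + ((i : ℕ) : ℤ) * (d : ℤ)) =
        (∑ i, (z i : ℤ)) * a + (∑ i, (z i : ℤ) * ((i : ℕ) : ℤ)) * d := by
    simp only [mul_add, Finset.sum_add_distrib, Finset.sum_mul, mul_assoc]
  constructor
  · rintro ⟨z, -, hn, rfl⟩
    refine ⟨by positivity, ∑ i, (z i : ℤ) * ((i : ℕ) : ℤ), by positivity, ?_, hn.trans (split z)⟩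
    rw [Finset.sum_mul]
    gcongr with i
    omega
  · rintro ⟨hl, k, hk, hkl, hn⟩
    lift l to ℕ using hl
    lift k to ℕ using hk
    obtain ⟨z, h1, h2⟩ := exists_multiplicities w l k (by exact_mod_cast hkl)
    exact ⟨z, by simp, by rw [split, h1, h2, hn], h1⟩

theorem ALen_empty_eq_image (a d w : ℕ) (hgcd : Nat.gcd a d = 1) (hw0 : 0 < w)
    (c1 c2 : ℤ) (hc2 : 0 ≤ c2) (hc2a : c2 < (a : ℤ)) :
    ALen a d w ∅ (c1 * a + c2 * d) =
      (fun t : ℤ => c1 - t * d) '' Set.Icc 0 ((c1 * w - c2) / ((a : ℤ) + w * d)) := by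
  have hpos : (0 : ℤ) < (a : ℤ) + w * d := by
    have : (0 : ℤ) < a := by omega
    positivity
  ext l
  simp only [mem_ALen_empty_iff, Set.mem_image, Set.mem_Icc, Int.le_ediv_iff_mul_le hpos]
  constructor
  · rintro ⟨-, k, hk, hkl, hn⟩
    have hdvd : (a : ℤ) ∣ k - c2 :=
      (Nat.isCoprime_iff_coprime.2 hgcd).dvd_of_dvd_mul_right ⟨c1 - l, by linarith⟩
    obtain ⟨t, ht⟩ := hdvd
    have hl : c1 - t * d = l := by
      have ha : (a : ℤ) ≠ 0 := by omega
      apply mul_left_cancel₀ ha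
      linear_combination hn + d * ht
    refine ⟨t, ⟨?_, ?_⟩, hl⟩
    · by_contra! h
      nlinarith
    · subst hl
      linarith
  · rintro ⟨t, ⟨ht, htq⟩, rfl⟩
    have hk : 0 ≤ c2 + a * t := by positivity
    have hkl : c2 + a * t ≤ (c1 - t * d) * w := by linarith
    exact ⟨nonneg_of_mul_nonneg_left (hk.trans hkl) (by exact_mod_cast hw0),
      c2 + a * t, hk, hkl, by ring⟩

theorem stmt3 (a d w : ℕ) (hgcd : Nat.gcd a d = 1) (hw0 : 0 < w) (hwa : w < a)
    (c1 c2 : ℤ) (hc2 : 0 ≤ c2) (hc2a : c2 < (a : ℤ))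
    (hn : AMem a d w ∅ (c1 * a + c2 * d)) :
    (ALen a d w ∅ (c1 * a + c2 * d)).ncard
      = ((c1 * w - c2) / ((a : ℤ) + w * d)).toNat + 1 := by
  have hd : (d : ℤ) ≠ 0 := by
    rintro h
    obtain rfl : d = 0 := by exact_mod_cast h
    rw [Nat.gcd_zero_right] at hgcd
    omega
  have hinj : Function.Injective fun t : ℤ => c1 - t * d := fun s t h =>
    mul_right_cancel₀ hd (sub_right_injective h)
  obtain ⟨z, hz, hsum⟩ := hn
  have hmem : (∑ i, (z i : ℤ)) ∈ ALen a d w ∅ (c1 * a + c2 * d) := ⟨z, hz, hsum, rfl⟩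
  rw [ALen_empty_eq_image a d w hgcd hw0 c1 c2 hc2 hc2a] at hmem ⊢
  obtain ⟨t, ⟨ht, htq⟩, -⟩ := hmem
  rw [Set.ncard_image_of_injective _ hinj, ← Finset.coe_Icc, Set.ncard_coe_finset, Int.card_Icc]
  omega
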